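/- For every z ∈ ℂ \ {0} and every ℓ ∈ ℤ, the Ramanujan entire function satisfies the two orthogonality relations: (1) ∑_{k=−∞}^{∞} z^k q^{k(k−1)/2} A_q(z q^{k+ℓ}) A_q(z q^{k−ℓ}) = (q;q)_∞² θ_q(−z) δ_{0,ℓ}, and (2) ∑_{k=−∞}^{∞} (−1)^k q^{k(k−1)/2} A_q(z q^{k+ℓ}) A_q(z^{−1} q^{k−ℓ}) = 0. -/

import Mathlib

open Complex Filter Topology

/-- Finite q-Pochhammer symbol `(a;q)_n`. -/
noncomputable def qp (q a : ℂ) (n : ℕ) : ℂ := ∏ k ∈ Finset.range n, (1 - a * q ^ k)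

/-- Infinite q-Pochhammer symbol `(a;q)_∞`. -/
noncomputable def qpInf (q a : ℂ) : ℂ := ∏' k : ℕ, (1 - a * q ^ k)

/-- Theta function `θ_q(x) = (x;q)_∞ (q/x;q)_∞`. -/
noncomputable def theta (q x : ℂ) : ℂ := qpInf q x * qpInf q (q / x)

/-- Ramanujan entire function with base `p`: `A_p(z) = ∑ (-1)^n p^{n²} z^n / (p;p)_n`. -/
noncomputable def ramanujanA (p z : ℂ) : ℂ :=
  ∑' n : ℕ, (-1) ^ n * p ^ (n ^ 2) * z ^ n / qp p p n

/-- General term `w^k q^{k(k-1)/2}` of the bilateral theta series. -/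
noncomputable def thetaTerm (q w : ℂ) (k : ℤ) : ℂ := w ^ k * q ^ (k * (k - 1) / 2)

lemma two_mul_triangle (k : ℤ) : 2 * (k * (k - 1) / 2) = k * (k - 1) :=
  Int.mul_ediv_cancel' (Int.even_mul_pred_self k).two_dvd

lemma triangle_add (k j : ℤ) :
    (k + j) * (k + j - 1) / 2 = k * (k - 1) / 2 + j * (j - 1) / 2 + k * j := by
  have h1 := two_mul_triangle (k + j)
  have h2 := two_mul_triangle k
  have h3 := two_mul_triangle j
  apply mul_left_cancel₀ (two_ne_zero (α := ℤ))
  linear_combination h1 - h2 - h3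

lemma triangle_neg (k : ℤ) : -k * (-k - 1) / 2 = k * (k - 1) / 2 + k := by
  have h1 := two_mul_triangle (-k)
  have h2 := two_mul_triangle k
  apply mul_left_cancel₀ (two_ne_zero (α := ℤ))
  linear_combination h1 - h2

@[simp]
lemma thetaTerm_zero (q w : ℂ) : thetaTerm q w 0 = 1 := by simp [thetaTerm]

@[simp]
lemma thetaTerm_one (q w : ℂ) : thetaTerm q w 1 = w := by simp [thetaTerm]

lemma thetaTerm_mul (q w v : ℂ) (k : ℤ) : thetaTerm q (w * v) k = thetaTerm q w k * v ^ k := by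
  simp only [thetaTerm, mul_zpow]; ring

lemma thetaTerm_add {q w : ℂ} (hq : q ≠ 0) (hw : w ≠ 0) (k j : ℤ) :
    thetaTerm q w (k + j) = thetaTerm q w k * thetaTerm q w j * q ^ (k * j) := by
  simp only [thetaTerm, triangle_add, zpow_add₀ hq, zpow_add₀ hw]; ring

lemma thetaTerm_neg {q : ℂ} (hq : q ≠ 0) (w : ℂ) (k : ℤ) :
    thetaTerm q w (-k) = thetaTerm q (q / w) k := by
  simp only [thetaTerm, triangle_neg, zpow_add₀ hq, zpow_neg, div_zpow]; ring

lemma thetaTerm_sub {q w : ℂ} (hq0 : q ≠ 0) (hw : w ≠ 0) (m n : ℤ) :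
    thetaTerm q w (m - n) = thetaTerm q w m * thetaTerm q (q / w) n * q ^ (-(m * n)) := by
  rw [sub_eq_add_neg, thetaTerm_add hq0 hw, thetaTerm_neg hq0, mul_neg]

lemma thetaTerm_ne_zero {q w : ℂ} (hq : q ≠ 0) (hw : w ≠ 0) (k : ℤ) : thetaTerm q w k ≠ 0 :=
  mul_ne_zero (zpow_ne_zero _ hw) (zpow_ne_zero _ hq)

lemma summable_thetaTerm_nat {q w : ℂ} (hq0 : q ≠ 0) (hq1 : ‖q‖ < 1) (hw : w ≠ 0) :
    Summable fun n : ℕ => ‖thetaTerm q w n‖ := by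
  rw [summable_norm_iff]
  refine summable_of_ratio_test_tendsto_lt_one zero_lt_one
    (.of_forall fun n => thetaTerm_ne_zero hq0 hw n) ?_
  have h : Tendsto (fun n : ℕ => ‖w‖ * ‖q‖ ^ n) atTop (𝓝 (‖w‖ * 0)) :=
    (tendsto_pow_atTop_nhds_zero_of_lt_one (norm_nonneg q) hq1).const_mul _
  rw [mul_zero] at h
  refine h.congr fun n => ?_
  have hn : ‖thetaTerm q w n‖ ≠ 0 := norm_ne_zero_iff.mpr (thetaTerm_ne_zero hq0 hw n)
  rw [Nat.cast_succ, thetaTerm_add hq0 hw, eq_div_iff hn]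
  simp; ring

lemma summable_thetaTerm {q w : ℂ} (hq0 : q ≠ 0) (hq1 : ‖q‖ < 1) (hw : w ≠ 0) :
    Summable fun k : ℤ => ‖thetaTerm q w k‖ := by
  refine .of_nat_of_neg (summable_thetaTerm_nat hq0 hq1 hw) ?_
  simp only [thetaTerm_neg hq0]
  exact summable_thetaTerm_nat hq0 hq1 (div_ne_zero hq0 hw)

lemma summable_norm_mul_pow {q : ℂ} (hq1 : ‖q‖ < 1) (a : ℂ) :
    Summable fun n : ℕ => ‖-(a * q ^ n)‖ := by
  simp only [norm_neg, norm_mul, norm_pow]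
  exact (summable_geometric_of_lt_one (norm_nonneg q) hq1).mul_left _

lemma tendsto_qp {q : ℂ} (hq1 : ‖q‖ < 1) (a : ℂ) :
    Tendsto (qp q a) atTop (𝓝 (qpInf q a)) := by
  have h := (multipliable_one_add_of_summable (summable_norm_mul_pow hq1 a)).hasProd.tendsto_prod_nat
  simp only [← sub_eq_add_neg] at h
  exact h

lemma qpInf_ne_zero {q a : ℂ} (hq1 : ‖q‖ < 1) (ha : ‖a‖ < 1) : qpInf q a ≠ 0 := by
  have h := tprod_one_add_ne_zero_of_summable (f := fun n : ℕ => -(a * q ^ n)) ?_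
    (summable_norm_mul_pow hq1 a)
  · simp only [← sub_eq_add_neg] at h
    exact h
  · intro n h
    rw [← sub_eq_add_neg, sub_eq_zero] at h
    have h2 : ‖a * q ^ n‖ < 1 := by
      rw [norm_mul, norm_pow]
      exact mul_lt_one_of_nonneg_of_lt_one_left (norm_nonneg a) ha
        (pow_le_one₀ (norm_nonneg q) hq1.le)
    rw [← h, norm_one] at h2
    exact lt_irrefl _ h2

lemma qp_succ (q a : ℂ) (n : ℕ) : qp q a (n + 1) = qp q a n * (1 - a * q ^ n) :=
  Finset.prod_range_succ _ _

lemma qp_succ' (q a : ℂ) (n : ℕ) : qp q a (n + 1) = (1 - a) * qp q (a * q) n := by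
  rw [qp, Finset.prod_range_succ', mul_comm]
  simp [qp, pow_succ', mul_assoc]

lemma qp_zero (q a : ℂ) : qp q a 0 = 1 := by simp [qp]

lemma qpInf_eq_mul {q : ℂ} (hq1 : ‖q‖ < 1) (a : ℂ) : qpInf q a = (1 - a) * qpInf q (a * q) := by
  refine tendsto_nhds_unique ((tendsto_qp hq1 a).comp (tendsto_add_atTop_nat 1)) ?_
  exact ((tendsto_qp hq1 (a * q)).const_mul (1 - a)).congr fun n => (qp_succ' q a n).symm

lemma qpInf_eq_qp_mul {q : ℂ} (hq1 : ‖q‖ < 1) (a : ℂ) (n : ℕ) :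
    qpInf q a = qp q a n * qpInf q (a * q ^ n) := by
  induction n with
  | zero => simp [qp_zero]
  | succ n ih =>
    rw [ih, qpInf_eq_mul hq1 (a * q ^ n), qp_succ, pow_succ]
    ring_nf

lemma qpInf_zpow_eq_zero {q : ℂ} (hq0 : q ≠ 0) {j : ℤ} (hj : j ≤ 0) : qpInf q (q ^ j) = 0 := by
  refine tprod_of_exists_eq_zero ⟨(-j).toNat, ?_⟩
  rw [← zpow_natCast, ← zpow_add₀ hq0, Int.toNat_of_nonneg (by lia)]
  simp

lemma qp_self_ne_zero {q : ℂ} (hq1 : ‖q‖ < 1) (n : ℕ) : qp q q n ≠ 0 := by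
  have h := qpInf_ne_zero hq1 hq1
  rw [qpInf_eq_qp_mul hq1 q n] at h
  exact left_ne_zero_of_mul h

lemma exists_norm_inv_qp_le {q : ℂ} (hq1 : ‖q‖ < 1) :
    ∃ C : ℝ, 0 ≤ C ∧ ∀ n, ‖(qp q q n)⁻¹‖ ≤ C := by
  obtain ⟨C, hC⟩ := (Metric.isBounded_range_of_tendsto _
    ((tendsto_qp hq1 q).inv₀ (qpInf_ne_zero hq1 hq1))).exists_norm_le
  have h : ∀ n, ‖(qp q q n)⁻¹‖ ≤ C := fun n => hC _ ⟨n, rfl⟩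
  exact ⟨C, (norm_nonneg _).trans (h 0), h⟩

lemma summable_norm_div_qp {q : ℂ} (hq1 : ‖q‖ < 1) {f : ℕ → ℂ} (hf : Summable fun n => ‖f n‖) :
    Summable fun n => ‖f n / qp q q n‖ := by
  obtain ⟨C, -, hC⟩ := exists_norm_inv_qp_le hq1
  refine .of_nonneg_of_le (fun _ => norm_nonneg _) (fun n => ?_) (hf.mul_right C)
  rw [div_eq_mul_inv, norm_mul]
  exact mul_le_mul_of_nonneg_left (hC n) (norm_nonneg _)

/-- A power series evaluated along `x q^N` converges to its constant term. -/
lemma tendsto_tsum_mul_pow {q : ℂ} (hq1 : ‖q‖ < 1) {f : ℕ → ℂ} (hf : Summable fun n => ‖f n‖) :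
    Tendsto (fun N : ℕ => ∑' n, f n * (q ^ N) ^ n) atTop (𝓝 (f 0)) := by
  have h0 : f 0 = ∑' n, if n = 0 then f n else 0 := by simp
  rw [h0]
  refine tendsto_tsum_of_dominated_convergence hf (fun n => ?_) (.of_forall fun N n => ?_)
  · rcases eq_or_ne n 0 with rfl | hn
    · simp
    · have h : Tendsto (fun N : ℕ => f n * (q ^ N) ^ n) atTop (𝓝 (f n * 0 ^ n)) :=
        ((tendsto_pow_atTop_nhds_zero_of_norm_lt_one hq1).pow n).const_mul _
      simpa [hn] using h
  · rw [norm_mul, ← pow_mul, norm_pow]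
    exact mul_le_of_le_one_right (norm_nonneg _) (pow_le_one₀ (norm_nonneg q) hq1.le)

lemma div_qp_succ_mul {q : ℂ} (hq1 : ‖q‖ < 1) (n : ℕ) (a : ℂ) :
    a / qp q q (n + 1) * (1 - q ^ (n + 1)) = a / qp q q n := by
  have h := qp_self_ne_zero hq1 (n + 1)
  have h' := qp_self_ne_zero hq1 n
  rw [qp_succ, ← pow_succ'] at *
  have := right_ne_zero_of_mul h
  field_simp

/-- Euler expansion of `(-w;q)_∞`. -/
lemma tsum_thetaTerm_div_qp {q w : ℂ} (hq0 : q ≠ 0) (hq1 : ‖q‖ < 1) (hw : w ≠ 0) :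
    ∑' n : ℕ, thetaTerm q w n / qp q q n = qpInf q (-w) := by
  have hs : ∀ {v : ℂ}, v ≠ 0 → Summable fun n : ℕ => ‖thetaTerm q v n / qp q q n‖ :=
    fun hv => summable_norm_div_qp hq1 (summable_thetaTerm_nat hq0 hq1 hv)
  have step : ∀ v : ℂ, v ≠ 0 → ∑' n : ℕ, thetaTerm q v n / qp q q n =
      (1 + v) * ∑' n : ℕ, thetaTerm q (v * q) n / qp q q n := by
    intro v hv
    have hvq : v * q ≠ 0 := mul_ne_zero hv hq0
    rw [one_add_mul, ← sub_eq_iff_eq_add', ← (hs hv).of_norm.tsum_sub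
      (hs hvq).of_norm, ← tsum_mul_left, ((hs hv).of_norm.sub (hs hvq).of_norm).tsum_eq_zero_add]
    simp only [Nat.cast_zero, thetaTerm_zero, sub_self, zero_add]
    refine tsum_congr fun n => ?_
    rw [thetaTerm_mul, thetaTerm_mul, zpow_natCast, zpow_natCast, ← sub_div, ← mul_one_sub,
      mul_div_right_comm, div_qp_succ_mul hq1, Nat.cast_succ, thetaTerm_add hq0 hv, mul_one,
      zpow_natCast, thetaTerm_one]
    ring
  have iter : ∀ N : ℕ, ∑' n : ℕ, thetaTerm q w n / qp q q n =
      qp q (-w) N * ∑' n : ℕ, thetaTerm q w n / qp q q n * (q ^ N) ^ n := by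
    intro N
    induction N with
    | zero => simp [qp_zero]
    | succ N ih =>
      have h := step (w * q ^ N) (mul_ne_zero hw (pow_ne_zero _ hq0))
      simp only [mul_assoc, ← pow_succ, thetaTerm_mul q w, zpow_natCast, mul_div_right_comm] at h
      rw [ih, h, qp_succ]
      ring
  have lim := (tendsto_qp hq1 (-w)).mul (tendsto_tsum_mul_pow hq1 (hs hw))
  simp only [← iter, Nat.cast_zero, thetaTerm_zero, qp_zero, div_one, mul_one] at lim
  exact tendsto_nhds_unique tendsto_const_nhds lim

lemma summable_pow_div_qp {q x : ℂ} (hq1 : ‖q‖ < 1) (hx : ‖x‖ < 1) :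
    Summable fun n : ℕ => ‖x ^ n / qp q q n‖ :=
  summable_norm_div_qp hq1 (summable_norm_geometric_of_norm_lt_one hx)

/-- Euler expansion of `1 / (x;q)_∞`. -/
lemma tsum_pow_div_qp_mul {q x : ℂ} (hq1 : ‖q‖ < 1) (hx : ‖x‖ < 1) :
    (∑' n : ℕ, x ^ n / qp q q n) * qpInf q x = 1 := by
  have step : ∀ v : ℂ, ‖v‖ < 1 → (∑' n : ℕ, v ^ n / qp q q n) * (1 - v) =
      ∑' n : ℕ, (v * q) ^ n / qp q q n := by
    intro v hv
    have hvq : ‖v * q‖ < 1 := by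
      rw [norm_mul]
      exact mul_lt_one_of_nonneg_of_lt_one_left (norm_nonneg v) hv hq1.le
    have s1 := (summable_pow_div_qp hq1 hv).of_norm
    have s2 := (summable_pow_div_qp hq1 hvq).of_norm
    rw [mul_one_sub, sub_eq_iff_eq_add', ← sub_eq_iff_eq_add, ← s1.tsum_sub s2, ← tsum_mul_right,
      (s1.sub s2).tsum_eq_zero_add]
    simp only [pow_zero, sub_self, zero_add]
    refine tsum_congr fun n => ?_
    rw [mul_pow, ← sub_div, ← mul_one_sub, mul_div_right_comm, div_qp_succ_mul hq1]
    ring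
  have iter : ∀ N : ℕ, (∑' n : ℕ, x ^ n / qp q q n) * qp q x N =
      ∑' n : ℕ, x ^ n / qp q q n * (q ^ N) ^ n := by
    intro N
    induction N with
    | zero => simp [qp_zero]
    | succ N ih =>
      have h := step (x * q ^ N) (by
        rw [norm_mul, norm_pow]
        exact mul_lt_one_of_nonneg_of_lt_one_left (norm_nonneg x) hx
          (pow_le_one₀ (norm_nonneg q) hq1.le))
      simp only [mul_assoc, ← pow_succ, mul_pow x, mul_div_right_comm] at h
      rw [qp_succ, ← mul_assoc, ih, h]
  have lim := (tendsto_qp hq1 x).const_mul (∑' n : ℕ, x ^ n / qp q q n)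
  simp only [iter] at lim
  have lim' := tendsto_tsum_mul_pow hq1 (summable_pow_div_qp hq1 hx)
  simpa [qp_zero] using tendsto_nhds_unique lim lim'

/-- Shifting the bilateral index decouples the theta series from the inner sum. -/
lemma hasSum_thetaTerm_shear {ι : Type*} {q w : ℂ} (hq0 : q ≠ 0) (hq1 : ‖q‖ < 1) (hw : w ≠ 0)
    (s : ι → ℤ) {a : ι → ℂ} (ha : Summable fun i => ‖a i‖) :
    HasSum (fun k : ℤ => ∑' i, thetaTerm q w (k + s i) * a i)
      ((∑' k : ℤ, thetaTerm q w k) * ∑' i, a i) := by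
  have hθ := summable_thetaTerm hq0 hq1 hw
  let e : ℤ × ι ≃ ℤ × ι :=
    { toFun := fun p => (p.1 + s p.2, p.2)
      invFun := fun p => (p.1 - s p.2, p.2)
      left_inv := fun p => by simp
      right_inv := fun p => by simp }
  have h := e.hasSum_iff.mpr
    (hθ.of_norm.hasSum.mul ha.of_norm.hasSum (summable_mul_of_summable_norm hθ ha))
  exact h.prod_fiberwise fun k => (h.summable.prod_factor k).hasSum

lemma tsum_thetaTerm_of_norm_lt {q w : ℂ} (hq0 : q ≠ 0) (hq1 : ‖q‖ < 1) (hw : w ≠ 0)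
    (hqw : ‖-(q / w)‖ < 1) : ∑' k : ℤ, thetaTerm q w k = qpInf q q * theta q (-w) := by
  have h := hasSum_thetaTerm_shear hq0 hq1 hw (fun m : ℕ => (m : ℤ)) (summable_pow_div_qp hq1 hqw)
  have inner : ∀ k : ℤ, ∑' m : ℕ, thetaTerm q w (k + m) * ((-(q / w)) ^ m / qp q q m) =
      thetaTerm q w k * qpInf q (q ^ (k + 1)) := by
    intro k
    rw [← neg_neg (q ^ (k + 1)), ← tsum_thetaTerm_div_qp hq0 hq1 (neg_ne_zero.mpr
      (zpow_ne_zero _ hq0)), ← tsum_mul_left]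
    refine tsum_congr fun m => ?_
    have e : -q ^ (k + 1) = w * (q ^ k * (-(q / w))) := by
      rw [zpow_add_one₀ hq0]; field_simp
    rw [e, thetaTerm_mul, thetaTerm_add hq0 hw, mul_zpow, ← zpow_mul, zpow_natCast]
    ring
  simp only [inner] at h
  have h' : HasSum (fun k : ℤ => thetaTerm q w k * qpInf q (q ^ (k + 1)))
      (qpInf q q * qpInf q (-w)) := by
    refine (Nat.cast_injective.hasSum_iff ?_).mp ?_
    · intro k hk
      have hk0 : k < 0 := by
        by_contra! h0
        exact hk ⟨k.toNat, Int.toNat_of_nonneg h0⟩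
      rw [qpInf_zpow_eq_zero hq0 (by lia), mul_zero]
    · rw [← tsum_thetaTerm_div_qp hq0 hq1 hw]
      refine ((summable_norm_div_qp hq1
        (summable_thetaTerm_nat hq0 hq1 hw)).of_norm.hasSum.mul_left (qpInf q q)).congr_fun ?_
      intro n
      have hn := qp_self_ne_zero hq1 n
      rw [Function.comp_apply, qpInf_eq_qp_mul hq1 q n, zpow_add_one₀ hq0, zpow_natCast,
        mul_comm (q ^ n)]
      field_simp
  have key := h.unique h'
  have hE := tsum_pow_div_qp_mul hq1 hqw
  rw [theta, div_neg, ← mul_assoc, ← key, mul_assoc, hE, mul_one]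

lemma tsum_thetaTerm_div {q w : ℂ} (hq0 : q ≠ 0) (hw : w ≠ 0) :
    ∑' k : ℤ, thetaTerm q (w / q) k = w / q * ∑' k : ℤ, thetaTerm q w k := by
  rw [← (Equiv.addRight (1 : ℤ)).tsum_eq (thetaTerm q (w / q)), ← tsum_mul_left]
  refine tsum_congr fun k => ?_
  rw [Equiv.coe_addRight, thetaTerm_add hq0 (div_ne_zero hw hq0), thetaTerm_one, mul_one,
    mul_right_comm, ← thetaTerm_mul, div_mul_cancel₀ _ hq0, mul_comm]

lemma theta_neg_div {q w : ℂ} (hq0 : q ≠ 0) (hq1 : ‖q‖ < 1) (hw : w ≠ 0) :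
    theta q (-(w / q)) = w / q * theta q (-w) := by
  rw [theta, theta, qpInf_eq_mul hq1 (-(w / q)), qpInf_eq_mul hq1 (q / -w)]
  have e1 : -(w / q) * q = -w := by field_simp
  have e2 : q / -w * q = q / -(w / q) := by field_simp
  rw [e1, e2]
  field_simp
  ring

/-- The Jacobi triple product identity. -/
lemma tsum_thetaTerm {q w : ℂ} (hq0 : q ≠ 0) (hq1 : ‖q‖ < 1) (hw : w ≠ 0) :
    ∑' k : ℤ, thetaTerm q w k = qpInf q q * theta q (-w) := by
  have descend : ∀ (N : ℕ) (v : ℂ), v ≠ 0 → ‖q ^ N * (q / v)‖ < 1 →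
      ∑' k : ℤ, thetaTerm q v k = qpInf q q * theta q (-v) := by
    intro N
    induction N with
    | zero =>
      intro v hv h
      exact tsum_thetaTerm_of_norm_lt hq0 hq1 hv (by simpa using h)
    | succ N ih =>
      intro v hv h
      have hvq := div_ne_zero hv hq0
      have e : q ^ N * (q / (v / q)) = q ^ (N + 1) * (q / v) := by
        rw [pow_succ]; field_simp
      have h2 := ih (v / q) hvq (e ▸ h)
      rw [tsum_thetaTerm_div hq0 hv, theta_neg_div hq0 hq1 hv, mul_left_comm] at h2
      exact mul_left_cancel₀ hvq h2
  have lim := ((tendsto_pow_atTop_nhds_zero_of_norm_lt_one hq1).mul_const (q / w)).norm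
  rw [zero_mul, norm_zero] at lim
  obtain ⟨N, hN⟩ := (lim.eventually_lt_const zero_lt_one).exists
  exact descend N w hw hN

lemma tsum_thetaTerm_neg_one {q : ℂ} (hq0 : q ≠ 0) (hq1 : ‖q‖ < 1) :
    ∑' k : ℤ, thetaTerm q (-1) k = 0 := by
  rw [tsum_thetaTerm hq0 hq1 (by simp), theta, neg_neg, ← zpow_zero q,
    qpInf_zpow_eq_zero hq0 le_rfl, zero_mul, mul_zero]

lemma ramanujanA_term_eq {q : ℂ} (hq0 : q ≠ 0) (x : ℂ) (m : ℕ) :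
    (-1) ^ m * q ^ (m ^ 2) * x ^ m / qp q q m =
      thetaTerm q (-x) m * (thetaTerm q 1 m * q ^ m) / qp q q m := by
  have e : q ^ (m ^ 2) = thetaTerm q 1 m * thetaTerm q 1 m * q ^ m := by
    have h := two_mul_triangle m
    simp only [thetaTerm, one_zpow, one_mul]
    rw [← zpow_natCast, ← zpow_natCast, ← zpow_add₀ hq0, ← zpow_add₀ hq0]
    congr 1
    push_cast
    linear_combination -h
  rw [e, ← one_mul (-x), thetaTerm_mul, neg_pow, zpow_natCast]
  ring

lemma summable_ramanujanA {q x : ℂ} (hq0 : q ≠ 0) (hq1 : ‖q‖ < 1) (hx : x ≠ 0) :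
    Summable fun m : ℕ => ‖(-1) ^ m * q ^ (m ^ 2) * x ^ m / qp q q m‖ := by
  simp only [ramanujanA_term_eq hq0]
  refine summable_norm_div_qp hq1 ?_
  have h := (summable_thetaTerm_nat hq0 hq1 (neg_ne_zero.mpr hx)).mul_of_nonneg
    (summable_thetaTerm_nat hq0 hq1 hq0) (fun _ => norm_nonneg _) (fun _ => norm_nonneg _)
  have hi : Function.Injective fun m : ℕ => (m, m) := fun _ _ h => (Prod.mk.inj h).1
  refine (h.comp_injective hi).congr fun m => ?_
  rw [Function.comp_apply, ← norm_mul, ← zpow_natCast q, ← thetaTerm_mul, one_mul]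

/-- Coefficient left after the bilateral sum of a product of two Ramanujan functions
has been separated from the theta series. -/
noncomputable def doubleCoeff (q u : ℂ) (p : ℕ × ℕ) : ℂ :=
  thetaTerm q (-u) ((p.1 : ℤ) - p.2) * q ^ p.1 / (qp q q p.1 * qp q q p.2)

lemma summable_doubleCoeff {q u : ℂ} (hq0 : q ≠ 0) (hq1 : ‖q‖ < 1) (hu : u ≠ 0) :
    Summable fun p => ‖doubleCoeff q u p‖ := by
  obtain ⟨C, hC0, hC⟩ := exists_norm_inv_qp_le hq1
  have hs := (summable_thetaTerm hq0 hq1 (neg_ne_zero.mpr hu)).mul_of_nonneg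
    (summable_geometric_of_lt_one (norm_nonneg q) hq1) (fun _ => norm_nonneg _)
    (fun _ => by positivity)
  have hi : Function.Injective fun p : ℕ × ℕ => ((p.1 : ℤ) - p.2, p.1) := by
    rintro ⟨m, n⟩ ⟨m', n'⟩ h
    simp only [Prod.mk.injEq] at h ⊢
    lia
  refine .of_nonneg_of_le (fun _ => norm_nonneg _) (fun p => ?_)
    ((hs.comp_injective hi).mul_right (C * C))
  rw [doubleCoeff, div_eq_mul_inv, mul_inv, norm_mul, norm_mul, norm_mul, norm_pow]
  exact mul_le_mul_of_nonneg_left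
    (mul_le_mul (hC _) (hC _) (norm_nonneg _) hC0) (by positivity)

lemma thetaTerm_mul_doubleCoeff {q w u : ℂ} (hq0 : q ≠ 0) (hw : w ≠ 0) (hu : u ≠ 0)
    (k : ℤ) (m n : ℕ) :
    thetaTerm q w (k + (m + n)) * doubleCoeff q u (m, n) =
      thetaTerm q w k *
        (((-1) ^ m * q ^ (m ^ 2) * (w * u * q ^ k) ^ m / qp q q m) *
          ((-1) ^ n * q ^ (n ^ 2) * (w * u⁻¹ * q ^ k) ^ n / qp q q n)) := by
  have e1 : -(w * u * q ^ k) = w * (-u * q ^ k) := by ring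
  have e2 : -(w * u⁻¹ * q ^ k) = w * (-u⁻¹ * q ^ k) := by ring
  have e3 : q / -u = 1 * (-u⁻¹ * q) := by field_simp
  have hmn : q ^ ((m : ℤ) * n) * q ^ (-((m : ℤ) * n)) = 1 := by
    rw [← zpow_add₀ hq0, add_neg_cancel, zpow_zero]
  rw [ramanujanA_term_eq hq0, ramanujanA_term_eq hq0, e1, e2, doubleCoeff,
    thetaTerm_add hq0 hw k, thetaTerm_add hq0 hw, thetaTerm_sub hq0 (neg_ne_zero.mpr hu), e3,
    ← one_mul (-u), thetaTerm_mul q 1, thetaTerm_mul q 1, thetaTerm_mul q w, thetaTerm_mul q w,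
    mul_add, zpow_add₀ hq0]
  simp only [zpow_mul q k, zpow_natCast, one_mul]
  simp only [div_eq_mul_inv, mul_inv]
  linear_combination (thetaTerm q w k * thetaTerm q w m * thetaTerm q w n *
    (q ^ k) ^ m * (q ^ k) ^ n * thetaTerm q 1 m * (-u) ^ m * thetaTerm q 1 n * (-u⁻¹) ^ n * q ^ n *
    q ^ m * (qp q q m)⁻¹ * (qp q q n)⁻¹) * hmn

lemma hasSum_thetaTerm_mul_ramanujanA {q w u : ℂ} (hq0 : q ≠ 0) (hq1 : ‖q‖ < 1) (hw : w ≠ 0)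
    (hu : u ≠ 0) :
    HasSum (fun k : ℤ => thetaTerm q w k * ramanujanA q (w * u * q ^ k) *
        ramanujanA q (w * u⁻¹ * q ^ k))
      ((∑' k : ℤ, thetaTerm q w k) * ∑' p, doubleCoeff q u p) := by
  refine (hasSum_thetaTerm_shear hq0 hq1 hw (fun p : ℕ × ℕ => (p.1 + p.2 : ℤ))
    (summable_doubleCoeff hq0 hq1 hu)).congr_fun fun k => ?_
  have hk := zpow_ne_zero k hq0
  rw [mul_assoc, ramanujanA, ramanujanA, tsum_mul_tsum_of_summable_norm
    (summable_ramanujanA hq0 hq1 (mul_ne_zero (mul_ne_zero hw hu) hk))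
    (summable_ramanujanA hq0 hq1 (mul_ne_zero (mul_ne_zero hw (inv_ne_zero hu)) hk)),
    ← tsum_mul_left]
  exact tsum_congr fun p => (thetaTerm_mul_doubleCoeff hq0 hw hu k p.1 p.2).symm

lemma tsum_doubleCoeff_fiber {q : ℂ} (hq0 : q ≠ 0) (hq1 : ‖q‖ < 1) (l : ℤ) (m : ℕ) :
    ∑' n, doubleCoeff q (q ^ l) (m, n) =
      thetaTerm q (-q ^ l) m * q ^ m / qp q q m * qpInf q (q ^ (1 - m - l)) := by
  have hl : -q ^ l ≠ 0 := neg_ne_zero.mpr (zpow_ne_zero _ hq0)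
  rw [← neg_neg (q ^ (1 - m - l)), ← tsum_thetaTerm_div_qp hq0 hq1 (neg_ne_zero.mpr
    (zpow_ne_zero _ hq0)), ← tsum_mul_left]
  refine tsum_congr fun n => ?_
  have e : -q ^ (1 - m - l) = q / -q ^ l * q ^ (-(m : ℤ)) := by
    rw [sub_right_comm, sub_eq_add_neg, zpow_add₀ hq0, zpow_sub₀ hq0, zpow_one]
    ring
  rw [e, thetaTerm_mul, doubleCoeff, thetaTerm_sub hq0 hl, ← zpow_mul, neg_mul]
  ring

lemma tsum_doubleCoeff {q : ℂ} (hq0 : q ≠ 0) (hq1 : ‖q‖ < 1) {l : ℤ} (hl : 0 ≤ l) :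
    ∑' p, doubleCoeff q (q ^ l) p = qpInf q q * if l = 0 then 1 else 0 := by
  rw [(summable_doubleCoeff hq0 hq1 (zpow_ne_zero l hq0)).of_norm.tsum_prod]
  simp only [tsum_doubleCoeff_fiber hq0 hq1]
  rw [tsum_eq_single 0]
  · split_ifs with h
    · simp [h, qp_zero]
    · rw [qpInf_zpow_eq_zero hq0 (by lia)]
      simp
  · intro m hm
    rw [qpInf_zpow_eq_zero hq0 (by lia), mul_zero]

lemma hasSum_ramanujanA_mul_of_nonneg {q z : ℂ} (hq0 : q ≠ 0) (hq1 : ‖q‖ < 1) (hz : z ≠ 0)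
    {l : ℤ} (hl : 0 ≤ l) :
    HasSum (fun k : ℤ => z ^ k * q ^ (k * (k - 1) / 2) *
        ramanujanA q (z * q ^ (k + l)) * ramanujanA q (z * q ^ (k - l)))
      (qpInf q q ^ 2 * theta q (-z) * (if l = 0 then 1 else 0)) := by
  have h := hasSum_thetaTerm_mul_ramanujanA hq0 hq1 hz (zpow_ne_zero l hq0)
  rw [tsum_thetaTerm hq0 hq1 hz, tsum_doubleCoeff hq0 hq1 hl] at h
  convert h using 1
  · ext k
    rw [zpow_add₀ hq0, zpow_sub₀ hq0, thetaTerm]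
    ring_nf
  · ring

theorem stmt_8 (q : ℝ) (hq0 : 0 < q) (hq1 : q < 1) (z : ℂ) (hz : z ≠ 0) (l : ℤ) :
    HasSum (fun k : ℤ => z ^ k * (q : ℂ) ^ (k * (k - 1) / 2) *
        ramanujanA (q : ℂ) (z * (q : ℂ) ^ (k + l)) * ramanujanA (q : ℂ) (z * (q : ℂ) ^ (k - l)))
      (qpInf (q : ℂ) (q : ℂ) ^ 2 * theta (q : ℂ) (-z) * (if l = 0 then 1 else 0)) ∧
    HasSum (fun k : ℤ => (-1) ^ k * (q : ℂ) ^ (k * (k - 1) / 2) *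
        ramanujanA (q : ℂ) (z * (q : ℂ) ^ (k + l)) *
        ramanujanA (q : ℂ) (z⁻¹ * (q : ℂ) ^ (k - l)))
      0 := by
  have hq0' : (q : ℂ) ≠ 0 := by exact_mod_cast hq0.ne'
  have hq1' : ‖(q : ℂ)‖ < 1 := by simpa [abs_of_pos hq0] using hq1
  constructor
  · rcases le_total 0 l with hl | hl
    · exact hasSum_ramanujanA_mul_of_nonneg hq0' hq1' hz hl
    · have h := hasSum_ramanujanA_mul_of_nonneg hq0' hq1' hz (neg_nonneg.mpr hl)
      simp only [sub_neg_eq_add, ← sub_eq_add_neg, neg_eq_zero] at h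
      exact h.congr_fun fun k => mul_right_comm _ _ _
  · have hu : -(z * (q : ℂ) ^ l) ≠ 0 := neg_ne_zero.mpr (mul_ne_zero hz (zpow_ne_zero l hq0'))
    have h := hasSum_thetaTerm_mul_ramanujanA hq0' hq1' (neg_ne_zero.mpr one_ne_zero) hu
    rw [tsum_thetaTerm_neg_one hq0' hq1', zero_mul] at h
    refine h.congr_fun fun k => ?_
    rw [thetaTerm, zpow_add₀ hq0', zpow_sub₀ hq0', inv_neg, mul_inv]
    ring_nf
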